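/- Boundary inequality for the operator T₁: under the Main Assumptions and the controllability condition, for every u ∈ C, every (w,z) ∈ {−1,1}², and every (x,y) ∈ ∂Ω_X^w × ∂Ω_Y^z, one has T₁[u](x,y,w,−z) ≤ u(x,y,−w,−z) ≤ T₁[u](x,y,−w,z). -/

import Mathlib

open Filter Set Topology MeasureTheory intervalIntegral
open scoped ENNReal

noncomputable section

/-- Euclidean space `ℝ^d`. -/
abbrev E (d : ℕ) := EuclideanSpace ℝ (Fin d)

/-- Measurable controls with values in the compact set `A`. -/
def Ctrl {d : ℕ} (A : Set (E d)) : Type :=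
  {a : ℝ → E d // Measurable a ∧ ∀ t : ℝ, a t ∈ A}

/-- Non-anticipating map from controls with values in `B` to controls with values in `A`
(a non-anticipating strategy). -/
def NAStrategy {d e : ℕ} (B : Set (E d)) (A : Set (E e)) (γ : Ctrl B → Ctrl A) : Prop :=
  ∀ t : ℝ, 0 ≤ t → ∀ β₁ β₂ : Ctrl B,
    (∀ᵐ s ∂(volume.restrict (Icc (0 : ℝ) t)), β₁.1 s = β₂.1 s) →
    (∀ᵐ s ∂(volume.restrict (Icc (0 : ℝ) t)), (γ β₁).1 s = (γ β₂).1 s)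

/-- A non-anticipating tuning: a non-anticipating map from the set of controls with
values in `A` to itself. -/
def NATuning {d : ℕ} (A : Set (E d)) (T : Ctrl A → Ctrl A) : Prop :=
  NAStrategy A A T

/-- The set of times `τ ∈ [0, t)` at which the input `X` is strictly beyond one of the
thresholds `ρm < ρp`. -/
def crossSet (ρm ρp : ℝ) (X : ℝ → ℝ) (t : ℝ) : Set ℝ :=
  {τ | 0 ≤ τ ∧ τ < t ∧ (X τ < ρm ∨ ρp < X τ)}

/-- `W` is the output of the delayed thermostat with thresholds `ρm < ρp`, input `X`
and initial output `w`. -/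
structure IsThermostat (ρm ρp : ℝ) (X : ℝ → ℝ) (w : ℝ) (W : ℝ → ℝ) : Prop where
  leftCont : ∀ t : ℝ, 0 < t → Tendsto W (nhdsWithin t (Iio t)) (nhds (W t))
  values : ∀ t : ℝ, 0 ≤ t → W t = 1 ∨ W t = -1
  high : ∀ t : ℝ, 0 ≤ t → ρp < X t → W t = 1
  low : ∀ t : ℝ, 0 ≤ t → X t < ρm → W t = -1
  band : ∀ t : ℝ, 0 ≤ t → ρm ≤ X t → X t ≤ ρp →
    ((crossSet ρm ρp X t).Nonempty →
      Tendsto W (nhdsWithin (sSup (crossSet ρm ρp X t)) (Iio (sSup (crossSet ρm ρp X t))))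
        (nhds (W t))) ∧
    (¬ (crossSet ρm ρp X t).Nonempty → W t = w)

/-- The data and standing ("Main") assumptions of the switching infinite-horizon
differential game: thresholds `ρ₋₁ < ρ₁` and `η₋₁ < η₁` of the two delayed thermostats,
compact control sets `A`, `B`, switching-dependent bounded Lipschitz dynamics `f`, `g`,
a nonnegative bounded Lipschitz running cost `ℓ = ℓ₁ + ℓ₂` decoupled in the controls,
a positive discount factor, and the controllability condition at the switching
thresholds. -/
structure Setting (n m k l : ℕ) where
  /-- lower threshold `ρ₋₁` for player `X` -/
  ρm : ℝ
  /-- upper threshold `ρ₁` for player `X` -/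
  ρp : ℝ
  /-- lower threshold `η₋₁` for player `Y` -/
  ηm : ℝ
  /-- upper threshold `η₁` for player `Y` -/
  ηp : ℝ
  hρ : ρm < ρp
  hη : ηm < ηp
  /-- control set of player `X` -/
  A : Set (E k)
  /-- control set of player `Y` -/
  B : Set (E l)
  hA : IsCompact A
  hB : IsCompact B
  hAne : A.Nonempty
  hBne : B.Nonempty
  /-- dynamics of player `X` -/
  f : E (n + 1) → ℝ → E k → E (n + 1)
  /-- dynamics of player `Y` -/
  g : E (m + 1) → ℝ → E l → E (m + 1)
  /-- first piece of the running cost -/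
  ℓ₁ : E (n + 1) → E (m + 1) → ℝ → ℝ → E k → ℝ
  /-- second piece of the running cost -/
  ℓ₂ : E (n + 1) → E (m + 1) → ℝ → ℝ → E l → ℝ
  /-- discount factor -/
  lam : ℝ
  /-- bound for dynamics and costs -/
  M : ℝ
  /-- Lipschitz constant -/
  L : ℝ
  hlam : 0 < lam
  hM : 0 < M
  hL : 0 < L
  hfCont : ∀ w : ℝ, w = 1 ∨ w = -1 →
    ContinuousOn (fun p : E (n + 1) × E k => f p.1 w p.2) (univ ×ˢ A)
  hgCont : ∀ z : ℝ, z = 1 ∨ z = -1 →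
    ContinuousOn (fun p : E (m + 1) × E l => g p.1 z p.2) (univ ×ˢ B)
  hfBdd : ∀ x w a, a ∈ A → ‖f x w a‖ ≤ M
  hgBdd : ∀ y z b, b ∈ B → ‖g y z b‖ ≤ M
  hfLip : ∀ w a x₁ x₂, a ∈ A → ‖f x₁ w a - f x₂ w a‖ ≤ L * ‖x₁ - x₂‖
  hgLip : ∀ z b y₁ y₂, b ∈ B → ‖g y₁ z b - g y₂ z b‖ ≤ L * ‖y₁ - y₂‖
  hℓ₁nn : ∀ x y w z a, 0 ≤ ℓ₁ x y w z a
  hℓ₂nn : ∀ x y w z b, 0 ≤ ℓ₂ x y w z b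
  hℓ₁Bdd : ∀ x y w z a, ℓ₁ x y w z a ≤ M
  hℓ₂Bdd : ∀ x y w z b, ℓ₂ x y w z b ≤ M
  hℓ₁Cont : ∀ w z : ℝ, w = 1 ∨ w = -1 → z = 1 ∨ z = -1 →
    ContinuousOn (fun p : (E (n + 1) × E (m + 1)) × E k => ℓ₁ p.1.1 p.1.2 w z p.2)
      (univ ×ˢ A)
  hℓ₂Cont : ∀ w z : ℝ, w = 1 ∨ w = -1 → z = 1 ∨ z = -1 →
    ContinuousOn (fun p : (E (n + 1) × E (m + 1)) × E l => ℓ₂ p.1.1 p.1.2 w z p.2)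
      (univ ×ˢ B)
  hℓ₁Lip : ∀ w z a x₁ y₁ x₂ y₂, a ∈ A →
    |ℓ₁ x₁ y₁ w z a - ℓ₁ x₂ y₂ w z a| ≤ L * (‖x₁ - x₂‖ + ‖y₁ - y₂‖)
  hℓ₂Lip : ∀ w z b x₁ y₁ x₂ y₂, b ∈ B →
    |ℓ₂ x₁ y₁ w z b - ℓ₂ x₂ y₂ w z b| ≤ L * (‖x₁ - x₂‖ + ‖y₁ - y₂‖)
  /-- controllability of player `X` at its switching thresholds -/
  hcontrX : ∀ w : ℝ, w = 1 ∨ w = -1 → ∀ x : E (n + 1),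
    ((w = 1 ∧ x 0 = ρm) ∨ (w = -1 ∧ x 0 = ρp)) →
    ∃ a₁ ∈ A, ∃ a₂ ∈ A, f x w a₁ 0 < 0 ∧ 0 < f x w a₂ 0
  /-- controllability of player `Y` at its switching thresholds -/
  hcontrY : ∀ z : ℝ, z = 1 ∨ z = -1 → ∀ y : E (m + 1),
    ((z = 1 ∧ y 0 = ηm) ∨ (z = -1 ∧ y 0 = ηp)) →
    ∃ b₁ ∈ B, ∃ b₂ ∈ B, g y z b₁ 0 < 0 ∧ 0 < g y z b₂ 0

namespace Setting

variable {n m k l : ℕ} (S : Setting n m k l)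

/-- Non-anticipating strategies of the minimizing player `X`. -/
def Strat : Type := {γ : Ctrl S.B → Ctrl S.A // NAStrategy S.B S.A γ}

/-- Non-anticipating strategies of the maximizing player `Y`. -/
def Xi : Type := {ξ : Ctrl S.A → Ctrl S.B // NAStrategy S.A S.B ξ}

/-- The full running cost `ℓ = ℓ₁ + ℓ₂`. -/
def runCost (x : E (n + 1)) (y : E (m + 1)) (w z : ℝ) (a : E k) (b : E l) : ℝ :=
  S.ℓ₁ x y w z a + S.ℓ₂ x y w z b

/-- The closed sector `Ω̄_X^w`. -/
def sectX (w : ℝ) : Set (E (n + 1)) :=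
  {x | (w = 1 ∧ S.ρm ≤ x 0) ∨ (w = -1 ∧ x 0 ≤ S.ρp)}

/-- The closed sector `Ω̄_Y^z`. -/
def sectY (z : ℝ) : Set (E (m + 1)) :=
  {y | (z = 1 ∧ S.ηm ≤ y 0) ∨ (z = -1 ∧ y 0 ≤ S.ηp)}

/-- The switching threshold (boundary) `∂Ω_X^w = {x : x₁ = ρ_{-w}}`. -/
def bdX (w : ℝ) : Set (E (n + 1)) :=
  {x | (w = 1 ∧ x 0 = S.ρm) ∨ (w = -1 ∧ x 0 = S.ρp)}

/-- The switching threshold (boundary) `∂Ω_Y^z = {y : y₁ = η_{-z}}`. -/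
def bdY (z : ℝ) : Set (E (m + 1)) :=
  {y | (z = 1 ∧ y 0 = S.ηm) ∨ (z = -1 ∧ y 0 = S.ηp)}

/-- The interior of the sector `Ω̄_X^w`. -/
def intX (w : ℝ) : Set (E (n + 1)) :=
  {x | (w = 1 ∧ S.ρm < x 0) ∨ (w = -1 ∧ x 0 < S.ρp)}

/-- The interior of the sector `Ω̄_Y^z`. -/
def intY (z : ℝ) : Set (E (m + 1)) :=
  {y | (z = 1 ∧ S.ηm < y 0) ∨ (z = -1 ∧ y 0 < S.ηp)}

/-- The pair of trajectory maps `(X, W)` of player `X` solves the thermostatic switching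
system: `X` solves the integral equation driven by `f` and the switching variable `W`,
and `W` is the delayed-thermostat output of the first coordinate of `X`. -/
def IsSolX (solX : E (n + 1) → ℝ → Ctrl S.A → ℝ → E (n + 1))
    (solW : E (n + 1) → ℝ → Ctrl S.A → ℝ → ℝ) : Prop :=
  ∀ (x : E (n + 1)) (w : ℝ) (α : Ctrl S.A), (w = 1 ∨ w = -1) →
    ((w = 1 ∧ S.ρm ≤ x 0) ∨ (w = -1 ∧ x 0 ≤ S.ρp)) →
    (∀ t : ℝ, 0 ≤ t →
      solX x w α t = x + ∫ s in (0 : ℝ)..t, S.f (solX x w α s) (solW x w α s) (α.1 s)) ∧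
    IsThermostat S.ρm S.ρp (fun t => solX x w α t 0) w (solW x w α)

/-- The pair of trajectory maps `(Y, Z)` of player `Y` solves the thermostatic switching
system. -/
def IsSolY (solY : E (m + 1) → ℝ → Ctrl S.B → ℝ → E (m + 1))
    (solZ : E (m + 1) → ℝ → Ctrl S.B → ℝ → ℝ) : Prop :=
  ∀ (y : E (m + 1)) (z : ℝ) (β : Ctrl S.B), (z = 1 ∨ z = -1) →
    ((z = 1 ∧ S.ηm ≤ y 0) ∨ (z = -1 ∧ y 0 ≤ S.ηp)) →
    (∀ t : ℝ, 0 ≤ t →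
      solY y z β t = y + ∫ s in (0 : ℝ)..t, S.g (solY y z β s) (solZ y z β s) (β.1 s)) ∧
    IsThermostat S.ηm S.ηp (fun t => solY y z β t 0) z (solZ y z β)

/-- The infinite-horizon discounted cost of the switching game. -/
def J (solX : E (n + 1) → ℝ → Ctrl S.A → ℝ → E (n + 1))
    (solW : E (n + 1) → ℝ → Ctrl S.A → ℝ → ℝ)
    (solY : E (m + 1) → ℝ → Ctrl S.B → ℝ → E (m + 1))
    (solZ : E (m + 1) → ℝ → Ctrl S.B → ℝ → ℝ)
    (x : E (n + 1)) (y : E (m + 1)) (w z : ℝ) (α : Ctrl S.A) (β : Ctrl S.B) : ℝ :=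
  ∫ t in Ioi (0 : ℝ), Real.exp (-S.lam * t) *
    S.runCost (solX x w α t) (solY y z β t) (solW x w α t) (solZ y z β t) (α.1 t) (β.1 t)

/-- The lower value function of the switching game. -/
def Vlow (solX : E (n + 1) → ℝ → Ctrl S.A → ℝ → E (n + 1))
    (solW : E (n + 1) → ℝ → Ctrl S.A → ℝ → ℝ)
    (solY : E (m + 1) → ℝ → Ctrl S.B → ℝ → E (m + 1))
    (solZ : E (m + 1) → ℝ → Ctrl S.B → ℝ → ℝ)
    (x : E (n + 1)) (y : E (m + 1)) (w z : ℝ) : ℝ :=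
  ⨅ γ : S.Strat, ⨆ β : Ctrl S.B, S.J solX solW solY solZ x y w z (γ.1 β) β

/-- The upper value function of the switching game. -/
def Vup (solX : E (n + 1) → ℝ → Ctrl S.A → ℝ → E (n + 1))
    (solW : E (n + 1) → ℝ → Ctrl S.A → ℝ → ℝ)
    (solY : E (m + 1) → ℝ → Ctrl S.B → ℝ → E (m + 1))
    (solZ : E (m + 1) → ℝ → Ctrl S.B → ℝ → ℝ)
    (x : E (n + 1)) (y : E (m + 1)) (w z : ℝ) : ℝ :=
  ⨆ ξ : S.Xi, ⨅ α : Ctrl S.A, S.J solX solW solY solZ x y w z α (ξ.1 α)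

end Setting

end

/-- First exit time (valued in `ℝ≥0∞`) of the curve `ξ` from the set `S`. -/
noncomputable def exitTime {d : ℕ} (S : Set (E d)) (ξ : ℝ → E d) : ℝ≥0∞ :=
  ⨅ t : {t : ℝ // 0 ≤ t ∧ ξ t ∉ S}, ENNReal.ofReal t.1

namespace Setting

variable {n m k l : ℕ} (S : Setting n m k l)

/-- Non-switching trajectory maps of player `X` with frozen switching label `w`:
`solXf w x α` solves `X' = f(X, w, α)`, `X(0) = x`. -/
def IsSolXf (solXf : ℝ → E (n + 1) → Ctrl S.A → ℝ → E (n + 1)) : Prop :=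
  ∀ (w : ℝ) (x : E (n + 1)) (α : Ctrl S.A), (w = 1 ∨ w = -1) →
    ∀ t : ℝ, 0 ≤ t →
      solXf w x α t = x + ∫ s in (0 : ℝ)..t, S.f (solXf w x α s) w (α.1 s)

/-- Non-switching trajectory maps of player `Y` with frozen switching label `z`. -/
def IsSolYf (solYf : ℝ → E (m + 1) → Ctrl S.B → ℝ → E (m + 1)) : Prop :=
  ∀ (z : ℝ) (y : E (m + 1)) (β : Ctrl S.B), (z = 1 ∨ z = -1) →
    ∀ t : ℝ, 0 ≤ t →
      solYf z y β t = y + ∫ s in (0 : ℝ)..t, S.g (solYf z y β s) z (β.1 s)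

open Classical in
/-- The cost of the exit-time/exit-costs differential game on the sector `B̄_{(w,z)}`
with frozen dynamics `f(·,w,·)`, `g(·,z,·)`, running cost `ℓ(·,·,w,z,·,·)` and exit
costs `ψX` (only `X` exits first), `ψY` (only `Y` exits first), `ψXY` (simultaneous
exit); no exit cost is paid if the trajectories never leave the sector. -/
noncomputable def Jexit
    (solXf : ℝ → E (n + 1) → Ctrl S.A → ℝ → E (n + 1))
    (solYf : ℝ → E (m + 1) → Ctrl S.B → ℝ → E (m + 1))
    (w z : ℝ) (ψX ψY ψXY : E (n + 1) → E (m + 1) → ℝ)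
    (x : E (n + 1)) (y : E (m + 1)) (α : Ctrl S.A) (β : Ctrl S.B) : ℝ :=
  let X := solXf w x α
  let Y := solYf z y β
  let τx := exitTime (S.sectX w) X
  let τy := exitTime (S.sectY z) Y
  let τ := min τx τy
  if τ = ⊤ then
    ∫ t in Ioi (0 : ℝ), Real.exp (-S.lam * t) * S.runCost (X t) (Y t) w z (α.1 t) (β.1 t)
  else
    (∫ t in Ioc (0 : ℝ) τ.toReal,
      Real.exp (-S.lam * t) * S.runCost (X t) (Y t) w z (α.1 t) (β.1 t)) +
      Real.exp (-S.lam * τ.toReal) *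
        (if τx < τy then ψX (X τ.toReal) (Y τ.toReal)
         else if τy < τx then ψY (X τ.toReal) (Y τ.toReal)
         else ψXY (X τ.toReal) (Y τ.toReal))

/-- The lower value of the exit-time/exit-costs differential game on the sector
`B̄_{(w,z)}` with exit costs `ψX`, `ψY`, `ψXY`. -/
noncomputable def Tval
    (solXf : ℝ → E (n + 1) → Ctrl S.A → ℝ → E (n + 1))
    (solYf : ℝ → E (m + 1) → Ctrl S.B → ℝ → E (m + 1))
    (w z : ℝ) (ψX ψY ψXY : E (n + 1) → E (m + 1) → ℝ)
    (x : E (n + 1)) (y : E (m + 1)) : ℝ :=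
  ⨅ γ : S.Strat, ⨆ β : Ctrl S.B,
    S.Jexit solXf solYf w z ψX ψY ψXY x y (γ.1 β) β

/-- The operator `T₁`: the exit costs are the values of `u` itself at the switched
labels. -/
noncomputable def T1
    (solXf : ℝ → E (n + 1) → Ctrl S.A → ℝ → E (n + 1))
    (solYf : ℝ → E (m + 1) → Ctrl S.B → ℝ → E (m + 1))
    (u : E (n + 1) → E (m + 1) → ℝ → ℝ → ℝ)
    (x : E (n + 1)) (y : E (m + 1)) (w z : ℝ) : ℝ :=
  S.Tval solXf solYf w z
    (fun x' y' => u x' y' (-w) z) (fun x' y' => u x' y' w (-z))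
    (fun x' y' => u x' y' (-w) (-z)) x y

/-- The operator `T₂`: as `T₁`, but the exit costs for the single exits are the values
of `T₁[u]`, while the simultaneous-exit cost is still `u(·,·,-w,-z)`. -/
noncomputable def T2
    (solXf : ℝ → E (n + 1) → Ctrl S.A → ℝ → E (n + 1))
    (solYf : ℝ → E (m + 1) → Ctrl S.B → ℝ → E (m + 1))
    (u : E (n + 1) → E (m + 1) → ℝ → ℝ → ℝ)
    (x : E (n + 1)) (y : E (m + 1)) (w z : ℝ) : ℝ :=
  S.Tval solXf solYf w z
    (fun x' y' => S.T1 solXf solYf u x' y' (-w) z)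
    (fun x' y' => S.T1 solXf solYf u x' y' w (-z))
    (fun x' y' => u x' y' (-w) (-z)) x y

/-- The operator `T₃`: as `T₂`, but with single-exit costs `T₂[u]` and
simultaneous-exit cost `T₁[u]`. -/
noncomputable def T3
    (solXf : ℝ → E (n + 1) → Ctrl S.A → ℝ → E (n + 1))
    (solYf : ℝ → E (m + 1) → Ctrl S.B → ℝ → E (m + 1))
    (u : E (n + 1) → E (m + 1) → ℝ → ℝ → ℝ)
    (x : E (n + 1)) (y : E (m + 1)) (w z : ℝ) : ℝ :=
  S.Tval solXf solYf w z
    (fun x' y' => S.T2 solXf solYf u x' y' (-w) z)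
    (fun x' y' => S.T2 solXf solYf u x' y' w (-z))
    (fun x' y' => S.T1 solXf solYf u x' y' (-w) (-z)) x y

/-- Membership in the set `C`: bounded, continuous in `(x,y)` on each sector, and
satisfying the corner compatibility inequalities. -/
def MemC (u : E (n + 1) → E (m + 1) → ℝ → ℝ → ℝ) : Prop :=
  (∃ Cb : ℝ, ∀ (w z : ℝ) (x : E (n + 1)) (y : E (m + 1)), |u x y w z| ≤ Cb) ∧
  (∀ w z : ℝ, w = 1 ∨ w = -1 → z = 1 ∨ z = -1 →
    ContinuousOn (fun p : E (n + 1) × E (m + 1) => u p.1 p.2 w z)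
      (S.sectX w ×ˢ S.sectY z)) ∧
  (∀ w z : ℝ, w = 1 ∨ w = -1 → z = 1 ∨ z = -1 →
    ∀ x ∈ S.bdX w, ∀ y ∈ S.bdY z,
      u x y w (-z) ≤ u x y (-w) (-z) ∧ u x y (-w) (-z) ≤ u x y (-w) z)

end Setting

lemma exitTime_eq_zero {d : ℕ} {D : Set (E d)} {ξ : ℝ → E d}
    (h : ∀ ε > 0, ∃ t, 0 < t ∧ t < ε ∧ ξ t ∉ D) : exitTime D ξ = 0 := by
  refine le_antisymm (ENNReal.le_of_forall_pos_le_add fun ε hε _ => ?_) zero_le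
  obtain ⟨t, ht0, htε, ht⟩ := h ε (by exact_mod_cast hε)
  rw [zero_add, exitTime]
  refine (iInf_le _ ⟨t, ht0.le, ht⟩).trans ?_
  exact ENNReal.ofReal_le_of_le_toReal (by simpa using htε.le)

lemma exitTime_pos {d : ℕ} {D : Set (E d)} {ξ : ℝ → E d} {δ : ℝ} (hδ : 0 < δ)
    (h : ∀ t, 0 ≤ t → t < δ → ξ t ∈ D) : 0 < exitTime D ξ := by
  refine (ENNReal.ofReal_pos.2 hδ).trans_le (le_iInf fun t => ENNReal.ofReal_le_ofReal ?_)
  by_contra! hlt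
  exact t.2.2 (h t.1 t.2.1 hlt)

/-- A solution of an integral equation with velocity bounded by `M` moves at speed at most `M`;
no measurability is needed. -/
lemma norm_sub_le_of_integral_eq {d : ℕ} {X v : ℝ → E d} {x : E d} {M : ℝ}
    (hX : ∀ t, 0 ≤ t → X t = x + ∫ s in (0 : ℝ)..t, v s) (hv : ∀ s, ‖v s‖ ≤ M)
    {t : ℝ} (ht : 0 ≤ t) : ‖X t - x‖ ≤ M * t := by
  rw [hX t ht, add_sub_cancel_left]
  simpa [abs_of_nonneg ht] using
    intervalIntegral.norm_integral_le_of_norm_le_const (a := 0) (b := t) fun s _ => hv s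

lemma abs_apply_sub_le_of_integral_eq {d : ℕ} {X v : ℝ → E d} {x : E d} {M : ℝ}
    (hX : ∀ t, 0 ≤ t → X t = x + ∫ s in (0 : ℝ)..t, v s) (hv : ∀ s, ‖v s‖ ≤ M)
    {t : ℝ} (ht : 0 ≤ t) (i : Fin d) : |X t i - x i| ≤ M * t := by
  simpa using (PiLp.norm_apply_le (X t - x) i).trans (norm_sub_le_of_integral_eq hX hv ht)

/-- If the velocity were not integrable near `0`, the solution would be constant and the velocity
constant as well, hence integrable. -/
lemma exists_intervalIntegrable_of_integral_eq {d : ℕ} {φ : E d → E d} {X : ℝ → E d} {x : E d}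
    (hX : ∀ t, 0 ≤ t → X t = x + ∫ s in (0 : ℝ)..t, φ (X s)) :
    ∃ T > 0, IntervalIntegrable (fun s => φ (X s)) volume 0 T := by
  by_contra! h
  have hconst : ∀ t, 0 < t → X t = x := fun t ht => by
    rw [hX t ht.le, intervalIntegral.integral_undef (h t ht), add_zero]
  refine h 1 one_pos ?_
  refine (intervalIntegrable_const (c := φ x)).congr fun s hs => ?_
  rw [uIoc_of_le zero_le_one] at hs
  simp only [hconst s hs.1]

/-- A solution of an autonomous Lipschitz integral equation moves strictly in the direction
prescribed by the initial velocity, at arbitrarily small times. -/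
lemma exists_small_time_lt {d : ℕ} {φ : E d → E d} {X : ℝ → E d} {x : E d} {M L : ℝ}
    (hM : 0 < M) (hL : 0 < L)
    (hX : ∀ t, 0 ≤ t → X t = x + ∫ s in (0 : ℝ)..t, φ (X s))
    (hφ : ∀ p, ‖φ p‖ ≤ M) (hLip : ∀ p q, ‖φ p - φ q‖ ≤ L * ‖p - q‖)
    {i : Fin d} {σ : ℝ} (hσ : σ = 1 ∨ σ = -1) (hdir : σ * φ x i < 0) :
    ∀ ε > 0, ∃ t, 0 < t ∧ t < ε ∧ σ * X t i < σ * x i := by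
  intro ε hε
  obtain ⟨T, hT, hint⟩ := exists_intervalIntegrable_of_integral_eq hX
  set c := -(σ * φ x i) with hc
  have hcpos : 0 < c := by linarith
  obtain ⟨t, ht0, ht⟩ : ∃ t, 0 < t ∧ t < min (min ε T) (c / (L * M)) :=
    exists_between (by positivity)
  simp only [lt_min_iff] at ht
  obtain ⟨⟨htε, htT⟩, htc⟩ := ht
  refine ⟨t, ht0, htε, ?_⟩
  have hint' : IntervalIntegrable (fun s => φ (X s)) volume 0 t :=
    hint.mono_set (by
      rw [uIcc_of_le ht0.le, uIcc_of_le hT.le]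
      exact Icc_subset_Icc_right htT.le)
  have hdiff : X t - x - t • φ x = ∫ s in (0 : ℝ)..t, (φ (X s) - φ x) := by
    rw [intervalIntegral.integral_sub hint' intervalIntegrable_const, hX t ht0.le]
    simp
  have hnorm : ‖X t - x - t • φ x‖ ≤ L * (M * t) * t := by
    rw [hdiff]
    have := intervalIntegral.norm_integral_le_of_norm_le_const (a := 0) (b := t)
      (f := fun s => φ (X s) - φ x) (C := L * (M * t)) fun s hs => by
        rw [uIoc_of_le ht0.le] at hs
        refine (hLip _ _).trans (mul_le_mul_of_nonneg_left ?_ hL.le)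
        exact (norm_sub_le_of_integral_eq hX (fun s => hφ (X s)) hs.1.le).trans
          (mul_le_mul_of_nonneg_left hs.2 hM.le)
    simpa [abs_of_pos ht0] using this
  have hcoord : |X t i - x i - t * φ x i| ≤ L * (M * t) * t := by
    simpa using (PiLp.norm_apply_le (X t - x - t • φ x) i).trans hnorm
  have hsmall : L * (M * t) * t < c * t := by
    rw [lt_div_iff₀ (by positivity)] at htc
    nlinarith
  obtain ⟨hlow, hupp⟩ := abs_le.1 hcoord
  rcases hσ with rfl | rfl <;> linarith

/-- The constant control. -/
def constCtrl {d : ℕ} {A : Set (E d)} (a : E d) (ha : a ∈ A) : Ctrl A :=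
  ⟨fun _ => a, measurable_const, fun _ => ha⟩

namespace Setting

variable {n m k l : ℕ} {S : Setting n m k l}
  {solXf : ℝ → E (n + 1) → Ctrl S.A → ℝ → E (n + 1)}
  {solYf : ℝ → E (m + 1) → Ctrl S.B → ℝ → E (m + 1)}

lemma IsSolXf.apply_zero (h : S.IsSolXf solXf) {w : ℝ} (hw : w = 1 ∨ w = -1)
    (x : E (n + 1)) (α : Ctrl S.A) : solXf w x α 0 = x := by
  simpa using h w x α hw 0 le_rfl

lemma IsSolYf.apply_zero (h : S.IsSolYf solYf) {z : ℝ} (hz : z = 1 ∨ z = -1)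
    (y : E (m + 1)) (β : Ctrl S.B) : solYf z y β 0 = y := by
  simpa using h z y β hz 0 le_rfl

/-- A point on the switching threshold of one label is in the interior of the opposite sector, so
trajectories starting there do not leave that sector immediately. -/
lemma IsSolXf.exitTime_neg_pos (h : S.IsSolXf solXf) {w : ℝ} {x : E (n + 1)} (hx : x ∈ S.bdX w)
    (α : Ctrl S.A) : 0 < exitTime (S.sectX (-w)) (solXf (-w) x α) := by
  have hM := S.hM
  have hρ := sub_pos.2 S.hρ
  refine exitTime_pos (δ := (S.ρp - S.ρm) / S.M) (by positivity) fun t ht htδ => ?_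
  rw [lt_div_iff₀ hM] at htδ
  have hw : -w = 1 ∨ -w = -1 := by rcases hx with ⟨rfl, -⟩ | ⟨rfl, -⟩ <;> simp
  obtain ⟨hlow, hupp⟩ := abs_le.1 <|
    abs_apply_sub_le_of_integral_eq (h (-w) x α hw) (fun s => S.hfBdd _ _ _ (α.2.2 s)) ht 0
  rcases hx with ⟨rfl, hx0⟩ | ⟨rfl, hx0⟩
  · exact Or.inr ⟨rfl, by linarith⟩
  · exact Or.inl ⟨by norm_num, by linarith⟩

/-- A point on the switching threshold of one label is in the interior of the opposite sector, so
trajectories starting there do not leave that sector immediately. -/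
lemma IsSolYf.exitTime_neg_pos (h : S.IsSolYf solYf) {z : ℝ} {y : E (m + 1)} (hy : y ∈ S.bdY z)
    (β : Ctrl S.B) : 0 < exitTime (S.sectY (-z)) (solYf (-z) y β) := by
  have hM := S.hM
  have hη := sub_pos.2 S.hη
  refine exitTime_pos (δ := (S.ηp - S.ηm) / S.M) (by positivity) fun t ht htδ => ?_
  rw [lt_div_iff₀ hM] at htδ
  have hz : -z = 1 ∨ -z = -1 := by rcases hy with ⟨rfl, -⟩ | ⟨rfl, -⟩ <;> simp
  obtain ⟨hlow, hupp⟩ := abs_le.1 <|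
    abs_apply_sub_le_of_integral_eq (h (-z) y β hz) (fun s => S.hgBdd _ _ _ (β.2.2 s)) ht 0
  rcases hy with ⟨rfl, hy0⟩ | ⟨rfl, hy0⟩
  · exact Or.inr ⟨rfl, by linarith⟩
  · exact Or.inl ⟨by norm_num, by linarith⟩

/-- By controllability, player `X` can leave the sector immediately from its threshold. -/
lemma IsSolXf.exists_exitTime_eq_zero (h : S.IsSolXf solXf) {w : ℝ} (hw : w = 1 ∨ w = -1)
    {x : E (n + 1)} (hx : x ∈ S.bdX w) :
    ∃ α : Ctrl S.A, exitTime (S.sectX w) (solXf w x α) = 0 := by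
  obtain ⟨a₁, ha₁, a₂, ha₂, hneg, hpos⟩ := S.hcontrX w hw x hx
  obtain ⟨a, ha, hdir⟩ : ∃ a ∈ S.A, w * S.f x w a 0 < 0 := by
    rcases hw with rfl | rfl
    · exact ⟨a₁, ha₁, by linarith⟩
    · exact ⟨a₂, ha₂, by linarith⟩
  refine ⟨constCtrl a ha, exitTime_eq_zero fun ε hε => ?_⟩
  obtain ⟨t, ht0, htε, ht⟩ := exists_small_time_lt (φ := fun p => S.f p w a) S.hM S.hL
    (h w x (constCtrl a ha) hw) (fun p => S.hfBdd p w a ha)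
    (fun p q => S.hfLip w a p q ha) hw hdir ε hε
  refine ⟨t, ht0, htε, ?_⟩
  rcases hx with ⟨rfl, hx0⟩ | ⟨rfl, hx0⟩ <;> rintro (⟨hl, hin⟩ | ⟨hl, hin⟩) <;> linarith

/-- By controllability, player `Y` can leave the sector immediately from its threshold. -/
lemma IsSolYf.exists_exitTime_eq_zero (h : S.IsSolYf solYf) {z : ℝ} (hz : z = 1 ∨ z = -1)
    {y : E (m + 1)} (hy : y ∈ S.bdY z) :
    ∃ β : Ctrl S.B, exitTime (S.sectY z) (solYf z y β) = 0 := by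
  obtain ⟨b₁, hb₁, b₂, hb₂, hneg, hpos⟩ := S.hcontrY z hz y hy
  obtain ⟨b, hb, hdir⟩ : ∃ b ∈ S.B, z * S.g y z b 0 < 0 := by
    rcases hz with rfl | rfl
    · exact ⟨b₁, hb₁, by linarith⟩
    · exact ⟨b₂, hb₂, by linarith⟩
  refine ⟨constCtrl b hb, exitTime_eq_zero fun ε hε => ?_⟩
  obtain ⟨t, ht0, htε, ht⟩ := exists_small_time_lt (φ := fun p => S.g p z b) S.hM S.hL
    (h z y (constCtrl b hb) hz) (fun p => S.hgBdd p z b hb)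
    (fun p q => S.hgLip z b p q hb) hz hdir ε hε
  refine ⟨t, ht0, htε, ?_⟩
  rcases hy with ⟨rfl, hy0⟩ | ⟨rfl, hy0⟩ <;> rintro (⟨hl, hin⟩ | ⟨hl, hin⟩) <;> linarith

/-- If `X` alone leaves the sector at time `0`, the cost is the corresponding exit cost. -/
lemma Jexit_eq_of_exitX (hX : S.IsSolXf solXf) (hY : S.IsSolYf solYf) {w z : ℝ}
    (hw : w = 1 ∨ w = -1) (hz : z = 1 ∨ z = -1) (ψX ψY ψXY : E (n + 1) → E (m + 1) → ℝ)
    {x : E (n + 1)} {y : E (m + 1)} {α : Ctrl S.A} {β : Ctrl S.B}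
    (hτx : exitTime (S.sectX w) (solXf w x α) = 0)
    (hτy : 0 < exitTime (S.sectY z) (solYf z y β)) :
    S.Jexit solXf solYf w z ψX ψY ψXY x y α β = ψX x y := by
  simp [Jexit, hτx, hτy, hX.apply_zero hw, hY.apply_zero hz]

/-- If `Y` alone leaves the sector at time `0`, the cost is the corresponding exit cost. -/
lemma Jexit_eq_of_exitY (hX : S.IsSolXf solXf) (hY : S.IsSolYf solYf) {w z : ℝ}
    (hw : w = 1 ∨ w = -1) (hz : z = 1 ∨ z = -1) (ψX ψY ψXY : E (n + 1) → E (m + 1) → ℝ)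
    {x : E (n + 1)} {y : E (m + 1)} {α : Ctrl S.A} {β : Ctrl S.B}
    (hτx : 0 < exitTime (S.sectX w) (solXf w x α))
    (hτy : exitTime (S.sectY z) (solYf z y β) = 0) :
    S.Jexit solXf solYf w z ψX ψY ψXY x y α β = ψY x y := by
  simp [Jexit, hτx, hτy, hX.apply_zero hw, hY.apply_zero hz]

lemma runCost_nonneg (x : E (n + 1)) (y : E (m + 1)) (w z : ℝ) (a : E k) (b : E l) :
    0 ≤ S.runCost x y w z a b :=
  add_nonneg (S.hℓ₁nn ..) (S.hℓ₂nn ..)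

lemma runCost_le (x : E (n + 1)) (y : E (m + 1)) (w z : ℝ) (a : E k) (b : E l) :
    S.runCost x y w z a b ≤ 2 * S.M := by
  rw [runCost]
  linarith [S.hℓ₁Bdd x y w z a, S.hℓ₂Bdd x y w z b]

lemma abs_discounted_integral_le (S : Setting n m k l) (I : Set ℝ) (hI : I ⊆ Ioi 0)
    (X : ℝ → E (n + 1)) (Y : ℝ → E (m + 1)) (w z : ℝ) (α : ℝ → E k) (β : ℝ → E l) :
    |∫ t in I, Real.exp (-S.lam * t) * S.runCost (X t) (Y t) w z (α t) (β t)| ≤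
      ∫ t in Ioi (0 : ℝ), Real.exp (-S.lam * t) * (2 * S.M) := by
  have hint : IntegrableOn (fun t => Real.exp (-S.lam * t) * (2 * S.M)) (Ioi 0) :=
    (exp_neg_integrableOn_Ioi 0 S.hlam).mul_const _
  have hM := S.hM
  rw [← Real.norm_eq_abs]
  refine (MeasureTheory.norm_integral_le_of_norm_le (hint.mono_set hI) (ae_of_all _ fun t => ?_)).trans
    (setIntegral_mono_set hint (ae_of_all _ fun t => by positivity) hI.eventuallyLE)
  rw [Real.norm_of_nonneg (mul_nonneg (Real.exp_pos _).le (runCost_nonneg ..))]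
  exact mul_le_mul_of_nonneg_left (runCost_le ..) (Real.exp_pos _).le

lemma exists_abs_Jexit_le (S : Setting n m k l)
    (solXf : ℝ → E (n + 1) → Ctrl S.A → ℝ → E (n + 1))
    (solYf : ℝ → E (m + 1) → Ctrl S.B → ℝ → E (m + 1)) (w z : ℝ)
    {ψX ψY ψXY : E (n + 1) → E (m + 1) → ℝ} {C : ℝ} (hψX : ∀ x y, |ψX x y| ≤ C)
    (hψY : ∀ x y, |ψY x y| ≤ C) (hψXY : ∀ x y, |ψXY x y| ≤ C) (x : E (n + 1)) (y : E (m + 1)) :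
    ∃ K, ∀ α β, |S.Jexit solXf solYf w z ψX ψY ψXY x y α β| ≤ K := by
  have hC : 0 ≤ C := (abs_nonneg _).trans (hψX x y)
  refine ⟨(∫ t in Ioi (0 : ℝ), Real.exp (-S.lam * t) * (2 * S.M)) + C, fun α β => ?_⟩
  unfold Jexit
  dsimp only
  split_ifs
  · exact (S.abs_discounted_integral_le _ Subset.rfl ..).trans (le_add_of_nonneg_right hC)
  all_goals
    refine (abs_add_le _ _).trans
      (add_le_add (S.abs_discounted_integral_le _ Ioc_subset_Ioi_self ..) ?_)
    rw [abs_mul, Real.abs_exp]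
    refine (mul_le_of_le_one_left (abs_nonneg _) (Real.exp_le_one_iff.2 ?_)).trans ?_
    · rw [neg_mul]
      exact neg_nonpos.2 (mul_nonneg S.hlam.le ENNReal.toReal_nonneg)
    · simp only [hψX, hψY, hψXY]

instance : Nonempty (Ctrl S.B) := ⟨constCtrl _ S.hBne.some_mem⟩

/-- The strategy that answers every control of the opponent by the same control. -/
def constStrat (α : Ctrl S.A) : S.Strat :=
  ⟨fun _ => α, fun _ _ _ _ _ => ae_of_all _ fun _ => rfl⟩

instance : Nonempty S.Strat := ⟨constStrat (constCtrl _ S.hAne.some_mem)⟩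

/-- If some control of `X` guarantees at most `c`, the lower value is at most `c`. -/
lemma Tval_le {w z : ℝ} {ψX ψY ψXY : E (n + 1) → E (m + 1) → ℝ} {x : E (n + 1)} {y : E (m + 1)}
    {K c : ℝ} (hK : ∀ α β, |S.Jexit solXf solYf w z ψX ψY ψXY x y α β| ≤ K) (α : Ctrl S.A)
    (hα : ∀ β, S.Jexit solXf solYf w z ψX ψY ψXY x y α β ≤ c) :
    S.Tval solXf solYf w z ψX ψY ψXY x y ≤ c := by
  refine (ciInf_le ⟨-K, ?_⟩ (constStrat α)).trans (ciSup_le hα)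
  rintro _ ⟨γ, rfl⟩
  obtain ⟨β⟩ : Nonempty (Ctrl S.B) := inferInstance
  exact (abs_le.1 (hK (γ.1 β) β)).1.trans
    (le_ciSup (f := fun β => S.Jexit solXf solYf w z ψX ψY ψXY x y (γ.1 β) β)
      ⟨K, by rintro _ ⟨β, rfl⟩; exact (abs_le.1 (hK _ _)).2⟩ β)

/-- If some control of `Y` guarantees at least `c`, the lower value is at least `c`. -/
lemma le_Tval {w z : ℝ} {ψX ψY ψXY : E (n + 1) → E (m + 1) → ℝ} {x : E (n + 1)} {y : E (m + 1)}
    {K c : ℝ} (hK : ∀ α β, |S.Jexit solXf solYf w z ψX ψY ψXY x y α β| ≤ K) (β : Ctrl S.B)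
    (hβ : ∀ α, c ≤ S.Jexit solXf solYf w z ψX ψY ψXY x y α β) :
    c ≤ S.Tval solXf solYf w z ψX ψY ψXY x y :=
  le_ciInf fun γ => (hβ (γ.1 β)).trans
    (le_ciSup (f := fun β => S.Jexit solXf solYf w z ψX ψY ψXY x y (γ.1 β) β)
      ⟨K, by rintro _ ⟨β, rfl⟩; exact (abs_le.1 (hK _ _)).2⟩ β)

end Setting

/-- **Boundary inequality for the operator `T₁`** (inequality (28)): under the Main
Assumptions and the controllability condition, for every `u ∈ C`, every
`(w, z) ∈ {-1,1}²` and every corner point `(x, y) ∈ ∂Ω_X^w × ∂Ω_Y^z`, one has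
`T₁[u](x,y,w,-z) ≤ u(x,y,-w,-z) ≤ T₁[u](x,y,-w,z)`. -/
theorem T1_boundary_inequality {n m k l : ℕ} (S : Setting n m k l)
    (solXf : ℝ → E (n + 1) → Ctrl S.A → ℝ → E (n + 1))
    (solYf : ℝ → E (m + 1) → Ctrl S.B → ℝ → E (m + 1))
    (hsolXf : S.IsSolXf solXf) (hsolYf : S.IsSolYf solYf) :
    ∀ u : E (n + 1) → E (m + 1) → ℝ → ℝ → ℝ, S.MemC u →
    ∀ w z : ℝ, w = 1 ∨ w = -1 → z = 1 ∨ z = -1 →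
    ∀ x ∈ S.bdX w, ∀ y ∈ S.bdY z,
      S.T1 solXf solYf u x y w (-z) ≤ u x y (-w) (-z) ∧
      u x y (-w) (-z) ≤ S.T1 solXf solYf u x y (-w) z := by
  intro u ⟨⟨C, hC⟩, _, _⟩ w z hw hz x hx y hy
  have hw' : -w = 1 ∨ -w = -1 := by rcases hw with rfl | rfl <;> simp
  have hz' : -z = 1 ∨ -z = -1 := by rcases hz with rfl | rfl <;> simp
  have hbdd (w z : ℝ) := S.exists_abs_Jexit_le solXf solYf w z (hC (-w) z) (hC w (-z))
    (hC (-w) (-z)) x y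
  constructor
  · obtain ⟨α, hα⟩ := hsolXf.exists_exitTime_eq_zero hw hx
    obtain ⟨K, hK⟩ := hbdd w (-z)
    exact Setting.Tval_le hK α fun β => (Setting.Jexit_eq_of_exitX hsolXf hsolYf hw hz' _ _ _ hα
      (hsolYf.exitTime_neg_pos hy β)).le
  · obtain ⟨β, hβ⟩ := hsolYf.exists_exitTime_eq_zero hz hy
    obtain ⟨K, hK⟩ := hbdd (-w) z
    exact Setting.le_Tval hK β fun α => (Setting.Jexit_eq_of_exitY hsolXf hsolYf hw' hz _
      (fun x' y' => u x' y' (-w) (-z)) _ (hsolXf.exitTime_neg_pos hx α) hβ).ge
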